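/- Terminating A_n q-binomial theorem (simplex sum): Let n be a positive integer, N a nonnegative integer, q a nonzero complex number that is not a root of unity, z a complex number, and x_1, …, x_n nonzero complex numbers such that x_i/x_j is not an integer power of q for i ≠ j. Then (z; q)_N = ∑_{k_1,…,k_n ≥ 0, |k| ≤ N} ∏_{1≤i<j≤n} (x_i·q^{k_i} − x_j·q^{k_j})/(x_i − x_j) · ∏_{i,j=1}^n (q·x_i/x_j; q)_{k_i}^{−1} · (q^{−N}; q)_{|k|} · q^{N·|k|} · z^{|k|}, where |k| = k_1 + ⋯ + k_n. -/

import Mathlib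

open Finset

/-- The q-shifted factorial `(a;q)_k`. -/
noncomputable def qPoch (q a : ℂ) (k : ℕ) : ℂ := ∏ i ∈ Finset.range k, (1 - a * q ^ i)

open Polynomial in
/-- Lagrange interpolation at `0` of the difference of two monic polynomials with roots `x`, `v`. -/
lemma sum_prod_sub_mul_lagrange {ι : Type*} [Fintype ι] [DecidableEq ι] (x v : ι → ℂ)
    (hv : Function.Injective v) :
    ∑ i, (∏ j, (v i - x j)) * ∏ j ∈ univ.erase i, v j / (v j - v i) =
      (∏ j, (-x j)) - ∏ j, (-v j) := by
  have hdeg : (Lagrange.nodal univ x - Lagrange.nodal univ v).degree < (univ : Finset ι).card := by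
    have h := degree_sub_lt_left (p := Lagrange.nodal univ x) (q := Lagrange.nodal univ v)
      (by rw [Lagrange.degree_nodal, Lagrange.degree_nodal])
      (Lagrange.nodal_ne_zero)
      (by rw [Lagrange.nodal_monic.leadingCoeff, Lagrange.nodal_monic.leadingCoeff])
    rwa [Lagrange.degree_nodal] at h
  have h := congrArg (eval 0) (Lagrange.eq_interpolate (s := univ) hv.injOn hdeg)
  simp only [Lagrange.interpolate_apply, eval_finsetSum, eval_mul, eval_C, eval_sub,
    Lagrange.eval_nodal, zero_sub, Lagrange.basis, eval_prod, Lagrange.basisDivisor, eval_X] at h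
  rw [h]
  refine sum_congr rfl fun i _ => ?_
  rw [prod_eq_zero (f := fun j => v i - v j) (mem_univ i) (sub_self _), sub_zero]
  congr 1
  refine prod_congr rfl fun j hj => ?_
  rw [← neg_sub (v i), div_neg, div_eq_mul_inv]
  ring

open Polynomial in
lemma sum_lagrange_zero {ι : Type*} [Fintype ι] [Nonempty ι] [DecidableEq ι] (v : ι → ℂ)
    (hv : Function.Injective v) :
    ∑ i, ∏ j ∈ univ.erase i, v j / (v j - v i) = 1 := by
  have h := congrArg (eval 0) (Lagrange.sum_basis (s := univ) hv.injOn univ_nonempty)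
  simp only [eval_finsetSum, eval_mul, eval_C, eval_sub, zero_sub, Lagrange.basis, eval_prod,
    Lagrange.basisDivisor, eval_X, eval_one] at h
  rw [← h]
  refine sum_congr rfl fun i _ => prod_congr rfl fun j _ => ?_
  rw [← neg_sub (v i), div_neg, div_eq_mul_inv]
  ring

/-- In a product over pairs of a symmetric function, the pairs containing `i` split off. -/
lemma prod_pairs_eq_mul {n : ℕ} (g : Fin n → Fin n → ℂ) (hg : ∀ a b, g a b = g b a) (i : Fin n) :
    (∏ a, ∏ b, if a < b then g a b else 1) =
      (∏ a, ∏ b, if a < b ∧ a ≠ i ∧ b ≠ i then g a b else 1) * ∏ j ∈ univ.erase i, g i j := by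
  have h1 : ∀ a b, (if a < b then g a b else 1) =
      (if a < b ∧ a ≠ i ∧ b ≠ i then g a b else 1) *
        ((if a = i then (if i < b then g i b else 1) else 1) *
          (if b = i then (if a < i then g i a else 1) else 1)) := by
    intro a b
    by_cases ha : a = i
    · subst ha
      by_cases hb : b = a
      · subst hb; simp
      · simp [hb]
    · by_cases hb : b = i
      · subst hb; simp [ha, hg a b]
      · simp [ha, hb]
  rw [prod_congr rfl fun a _ => prod_congr rfl fun b _ => h1 a b]
  simp_rw [prod_mul_distrib]
  congr 1
  rw [prod_comm (f := fun a b => if a = i then (if i < b then g i b else 1) else 1)]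
  simp only [prod_ite_eq', mem_univ, if_true]
  rw [← prod_mul_distrib, ← mul_prod_erase univ _ (mem_univ i)]
  simp only [lt_irrefl, if_false, mul_one, one_mul]
  refine prod_congr rfl fun j hj => ?_
  rcases lt_or_gt_of_ne (ne_of_mem_erase hj) with h | h
  · simp [h, h.not_gt]
  · simp [h, h.not_gt]

lemma qPoch_succ (q a : ℂ) (k : ℕ) : qPoch q a (k + 1) = qPoch q a k * (1 - a * q ^ k) :=
  prod_range_succ _ _

/-- The coefficient of the `A_n` q-binomial series at the multi-index `k`. -/
noncomputable def simplexCoeff {n : ℕ} (q : ℂ) (x : Fin n → ℂ) (k : Fin n → ℕ) : ℂ :=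
  (∏ i, ∏ j, if i < j then (x i * q ^ k i - x j * q ^ k j) / (x i - x j) else 1) *
    ∏ i, ∏ j, (qPoch q (q * x i / x j) (k i))⁻¹

lemma injective_mul_pow {n : ℕ} {q : ℂ} (hq : q ≠ 0) {x : Fin n → ℂ} (hx : ∀ i, x i ≠ 0)
    (hxq : ∀ i j : Fin n, i ≠ j → ∀ m : ℤ, x i / x j ≠ q ^ m) (k : Fin n → ℕ) :
    Function.Injective fun i => x i * q ^ k i := by
  intro i j hij
  by_contra hne
  refine hxq i j hne ((k j : ℤ) - k i) ?_
  rw [zpow_sub₀ hq, zpow_natCast, zpow_natCast,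
    div_eq_div_iff (hx j) (pow_ne_zero _ hq)]
  simpa [mul_comm] using hij

lemma one_sub_mul_div_mul_pow_ne_zero {n : ℕ} {q : ℂ} (hqru : ∀ m : ℕ, 0 < m → q ^ m ≠ 1)
    {x : Fin n → ℂ} (hx : ∀ i, x i ≠ 0)
    (hxq : ∀ i j : Fin n, i ≠ j → ∀ m : ℤ, x i / x j ≠ q ^ m) (i j : Fin n) (k : ℕ) :
    1 - q * x i / x j * q ^ k ≠ 0 := by
  intro h
  have h1 : x i / x j * q ^ (k + 1) = 1 := by rw [pow_succ]; linear_combination -h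
  by_cases hij : i = j
  · subst hij
    rw [div_self (hx i), one_mul] at h1
    exact hqru _ k.succ_pos h1
  · refine hxq i j hij (-((k + 1 : ℕ) : ℤ)) ?_
    rw [zpow_neg, zpow_natCast]
    exact eq_inv_of_mul_eq_one_left h1

lemma simplexCoeff_add_single {n : ℕ} {q : ℂ} (hq : q ≠ 0) (hqru : ∀ m : ℕ, 0 < m → q ^ m ≠ 1)
    {x : Fin n → ℂ} (hx : ∀ i, x i ≠ 0)
    (hxq : ∀ i j : Fin n, i ≠ j → ∀ m : ℤ, x i / x j ≠ q ^ m) (k K : Fin n → ℕ) (i : Fin n)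
    (hi : K i = k i + 1) (hK : ∀ j, j ≠ i → K j = k j) :
    simplexCoeff q x k *
        ∏ j ∈ univ.erase i, (x j * q ^ k j) / (x j * q ^ k j - x i * q ^ k i) =
      simplexCoeff q x K *
        ((∏ j, (1 - x i * q ^ K i / x j)) *
          ∏ j ∈ univ.erase i, (x j * q ^ K j) / (x j * q ^ K j - x i * q ^ K i)) := by
  have hsymm : ∀ (k : Fin n → ℕ) (a b : Fin n), (x a * q ^ k a - x b * q ^ k b) / (x a - x b) =
      (x b * q ^ k b - x a * q ^ k a) / (x b - x a) := fun k a b => by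
    rw [← neg_sub (x b * q ^ k b), ← neg_sub (x b), neg_div_neg_eq]
  have hpairs : (∏ a, ∏ b, if a < b ∧ a ≠ i ∧ b ≠ i then
        (x a * q ^ K a - x b * q ^ K b) / (x a - x b) else 1) =
      ∏ a, ∏ b, if a < b ∧ a ≠ i ∧ b ≠ i then
        (x a * q ^ k a - x b * q ^ k b) / (x a - x b) else 1 := by
    refine prod_congr rfl fun a _ => prod_congr rfl fun b _ => ?_
    split_ifs with h
    · rw [hK a h.2.1, hK b h.2.2]
    · rfl
  have hrows : (∏ a ∈ univ.erase i, ∏ j, (qPoch q (q * x a / x j) (K a))⁻¹) =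
      ∏ a ∈ univ.erase i, ∏ j, (qPoch q (q * x a / x j) (k a))⁻¹ :=
    prod_congr rfl fun a ha => by rw [hK a (ne_of_mem_erase ha)]
  have hrow : (∏ j, (qPoch q (q * x i / x j) (k i))⁻¹) =
      (∏ j, (qPoch q (q * x i / x j) (K i))⁻¹) * ∏ j, (1 - x i * q ^ K i / x j) := by
    rw [← prod_mul_distrib]
    refine prod_congr rfl fun j _ => ?_
    have hne := one_sub_mul_div_mul_pow_ne_zero hqru hx hxq i j (k i)
    have he : 1 - x i * q ^ K i / x j = 1 - q * x i / x j * q ^ k i := by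
      rw [hi, pow_succ]; ring
    rw [he, hi, qPoch_succ, mul_inv, mul_assoc, inv_mul_cancel₀ hne, mul_one]
  have hcancel : ∀ k : Fin n → ℕ,
      (∏ j ∈ univ.erase i, (x i * q ^ k i - x j * q ^ k j) / (x i - x j)) *
        ∏ j ∈ univ.erase i, (x j * q ^ k j) / (x j * q ^ k j - x i * q ^ k i) =
      ∏ j ∈ univ.erase i, -(x j * q ^ k j) / (x i - x j) := by
    intro k
    rw [← prod_mul_distrib]
    refine prod_congr rfl fun j hj => ?_
    have hne : x j * q ^ k j - x i * q ^ k i ≠ 0 :=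
      sub_ne_zero.2 ((injective_mul_pow hq hx hxq k).ne (ne_of_mem_erase hj))
    rw [← neg_sub (x j * q ^ k j) (x i * q ^ k i), div_mul_div_comm, neg_mul,
      mul_comm _ (x j * q ^ k j), ← neg_mul, mul_div_mul_right _ _ hne]
  have hnum : (∏ j ∈ univ.erase i, -(x j * q ^ K j) / (x i - x j)) =
      ∏ j ∈ univ.erase i, -(x j * q ^ k j) / (x i - x j) :=
    prod_congr rfl fun j hj => by rw [hK j (ne_of_mem_erase hj)]
  have hk := hcancel k
  have hK' := hcancel K
  rw [hnum, ← hk] at hK'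
  unfold simplexCoeff
  rw [prod_pairs_eq_mul _ (hsymm k) i, prod_pairs_eq_mul _ (hsymm K) i, hpairs,
    ← mul_prod_erase univ (fun a => ∏ j, (qPoch q (q * x a / x j) (k a))⁻¹) (mem_univ i),
    ← mul_prod_erase univ (fun a => ∏ j, (qPoch q (q * x a / x j) (K a))⁻¹) (mem_univ i),
    hrows, hrow]
  generalize (∏ j ∈ univ.erase i, (x j * q ^ k j) / (x j * q ^ k j - x i * q ^ k i)) = A at *
  generalize (∏ j ∈ univ.erase i, (x j * q ^ K j) / (x j * q ^ K j - x i * q ^ K i)) = B at *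
  generalize (∏ a ∈ univ.erase i, ∏ j, (qPoch q (q * x a / x j) (k a))⁻¹) = C
  generalize (∏ j, (qPoch q (q * x i / x j) (K i))⁻¹) = D
  generalize (∏ j, (1 - x i * q ^ K i / x j)) = E
  generalize (∏ a, ∏ b, if a < b ∧ a ≠ i ∧ b ≠ i then
        (x a * q ^ k a - x b * q ^ k b) / (x a - x b) else 1) = F
  linear_combination (-C * D * E * F) * hK'

lemma sum_prod_one_sub_mul_lagrange {n : ℕ} {q : ℂ} (hq : q ≠ 0) {x : Fin n → ℂ}
    (hx : ∀ i, x i ≠ 0) (hxq : ∀ i j : Fin n, i ≠ j → ∀ m : ℤ, x i / x j ≠ q ^ m)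
    (k : Fin n → ℕ) :
    ∑ i, ((∏ j, (1 - x i * q ^ k i / x j)) *
        ∏ j ∈ univ.erase i, (x j * q ^ k j) / (x j * q ^ k j - x i * q ^ k i)) =
      1 - q ^ ∑ i, k i := by
  have h := sum_prod_sub_mul_lagrange x _ (injective_mul_pow hq hx hxq k)
  have hne : (∏ j, (-x j)) ≠ 0 := prod_ne_zero_iff.2 fun j _ => neg_ne_zero.2 (hx j)
  apply mul_left_cancel₀ hne
  have hr : (∏ j, -(x j * q ^ k j)) = (∏ j, (-x j)) * q ^ ∑ i, k i := by
    rw [← prod_pow_eq_pow_sum, ← prod_mul_distrib]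
    exact prod_congr rfl fun j _ => by ring
  rw [mul_sub, mul_one, ← hr, ← h, mul_sum]
  refine sum_congr rfl fun i _ => ?_
  rw [← mul_assoc, ← prod_mul_distrib]
  congr 1
  refine prod_congr rfl fun j _ => ?_
  have := hx j
  field_simp
  ring

lemma sum_piAntidiag_succ {n : ℕ} (m : ℕ) (F : (Fin n → ℕ) → Fin n → ℂ)
    (hF : ∀ k i, k i = 0 → F k i = 0) :
    ∑ K ∈ piAntidiag univ (m + 1), ∑ i, F K i =
      ∑ k ∈ piAntidiag univ m, ∑ i, F (k + Pi.single i 1) i := by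
  rw [sum_comm, sum_comm (s := piAntidiag univ m)]
  refine sum_congr rfl fun i _ => ?_
  symm
  refine sum_of_injOn (fun k => k + Pi.single i 1) (add_left_injective _).injOn ?_ ?_
    (fun _ _ => rfl)
  · intro k hk
    simp only [mem_coe, mem_piAntidiag] at hk ⊢
    simp [sum_add_distrib, hk.1]
  · intro K hK hKi
    refine hF K i ?_
    by_contra hne
    have hle : Pi.single i 1 ≤ K := by
      intro j
      by_cases hj : j = i
      · subst hj; simpa using Nat.one_le_iff_ne_zero.2 hne
      · simp [hj]
    refine hKi ⟨K - Pi.single i 1, ?_, tsub_add_cancel_of_le hle⟩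
    simp only [mem_coe, mem_piAntidiag, mem_univ, implies_true, and_true] at hK ⊢
    have h : ∑ j, ((K - Pi.single i 1 + Pi.single i 1 : Fin n → ℕ)) j = m + 1 := by
      rw [tsub_add_cancel_of_le hle]; exact hK
    simp only [Pi.add_apply, sum_add_distrib] at h
    simpa using h

/-- The coefficients of total degree `m` sum to `1 / (q;q)_m`. -/
lemma sum_simplexCoeff {n : ℕ} (hn : 0 < n) {q : ℂ} (hq : q ≠ 0)
    (hqru : ∀ m : ℕ, 0 < m → q ^ m ≠ 1) {x : Fin n → ℂ} (hx : ∀ i, x i ≠ 0)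
    (hxq : ∀ i j : Fin n, i ≠ j → ∀ m : ℤ, x i / x j ≠ q ^ m) (m : ℕ) :
    qPoch q q m * ∑ k ∈ piAntidiag univ m, simplexCoeff q x k = 1 := by
  have : Nonempty (Fin n) := ⟨⟨0, hn⟩⟩
  induction m with
  | zero =>
    have hd : ∀ i j : Fin n, i < j → (x i - x j) / (x i - x j) = 1 := fun i j hij =>
      div_self <| sub_ne_zero.2 <| by
        simpa using (injective_mul_pow hq hx hxq 0).ne hij.ne
    have h1 : ∀ i j : Fin n, (if i < j then (x i - x j) / (x i - x j) else 1) = 1 := fun i j => by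
      split_ifs with h
      · exact hd i j h
      · rfl
    simp [simplexCoeff, qPoch, h1]
  | succ m ih =>
    rw [qPoch_succ, mul_assoc]
    refine Eq.trans ?_ ih
    congr 1
    rw [mul_sum]
    have h : ∀ K ∈ piAntidiag (univ : Finset (Fin n)) (m + 1),
        (1 - q * q ^ m) * simplexCoeff q x K = ∑ i, simplexCoeff q x K *
          ((∏ j, (1 - x i * q ^ K i / x j)) *
            ∏ j ∈ univ.erase i, (x j * q ^ K j) / (x j * q ^ K j - x i * q ^ K i)) := by
      intro K hK
      rw [← mul_sum, sum_prod_one_sub_mul_lagrange hq hx hxq, (mem_piAntidiag.1 hK).1, pow_succ']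
      ring
    rw [sum_congr rfl h, sum_piAntidiag_succ]
    · refine sum_congr rfl fun k _ => ?_
      refine Eq.trans ?_ ((mul_sum _ _ _).symm.trans <| (congrArg (simplexCoeff q x k * ·)
        (sum_lagrange_zero _ (injective_mul_pow hq hx hxq k))).trans (mul_one _))
      refine sum_congr rfl fun i _ => ?_
      exact (simplexCoeff_add_single hq hqru hx hxq k (k + Pi.single i 1) i
        (by simp) fun j hj => by simp [hj]).symm
    · intro K i hi
      rw [prod_eq_zero (mem_univ i) (by simp [hi, hx i]), zero_mul, mul_zero]

lemma qPoch_zpow_neg_mul_pow {q : ℂ} (hq : q ≠ 0) (N m : ℕ) :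
    qPoch q (q ^ (-(N : ℤ))) m * q ^ (N * m) = ∏ i ∈ range m, (q ^ N - q ^ i) := by
  rw [pow_mul, qPoch, ← card_range m, ← prod_const, card_range, ← prod_mul_distrib]
  refine prod_congr rfl fun i _ => ?_
  have := pow_ne_zero N hq
  rw [zpow_neg, zpow_natCast]
  field_simp

lemma prod_pow_sub_pow_succ (q : ℂ) (N m : ℕ) :
    ∏ i ∈ range (m + 1), (q ^ (N + 1) - q ^ i) =
      (q ^ (N + 1) - 1) * q ^ m * ∏ i ∈ range m, (q ^ N - q ^ i) := by
  rw [prod_range_succ', pow_zero, mul_comm, mul_assoc]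
  congr 1
  rw [← card_range m, ← prod_const, card_range, ← prod_mul_distrib]
  exact prod_congr rfl fun i _ => by ring

/-- The terminating q-binomial theorem. -/
lemma qPoch_eq_sum {q : ℂ} (hqru : ∀ m : ℕ, 0 < m → q ^ m ≠ 1) (z : ℂ) (N : ℕ) :
    qPoch q z N =
      ∑ m ∈ range (N + 1), (∏ i ∈ range m, (q ^ N - q ^ i)) / qPoch q q m * z ^ m := by
  have hne : ∀ m, qPoch q q m ≠ 0 := fun m => prod_ne_zero_iff.2 fun i _ => by
    rw [← pow_succ', sub_ne_zero]
    exact (hqru _ i.succ_pos).symm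
  induction N with
  | zero => simp [qPoch]
  | succ N ih =>
    have hrec : ∀ m, (∏ i ∈ range (m + 1), (q ^ (N + 1) - q ^ i)) / qPoch q q (m + 1) =
        (∏ i ∈ range (m + 1), (q ^ N - q ^ i)) / qPoch q q (m + 1) -
          q ^ N * ((∏ i ∈ range m, (q ^ N - q ^ i)) / qPoch q q m) := by
      intro m
      have h1 := hne m
      have h2 := hne (m + 1)
      rw [qPoch_succ] at h2 ⊢
      have h3 := right_ne_zero_of_mul h2
      rw [← pow_succ'] at h3 ⊢
      rw [prod_pow_sub_pow_succ, prod_range_succ]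
      field_simp
      ring
    have htop : (∏ i ∈ range (N + 1), (q ^ N - q ^ i)) = 0 :=
      prod_eq_zero (self_mem_range_succ N) (sub_self _)
    rw [sum_range_succ']
    simp_rw [hrec, sub_mul, sum_sub_distrib]
    rw [sum_range_succ (fun m => (∏ i ∈ range (m + 1), (q ^ N - q ^ i)) / _ * z ^ (m + 1)),
      htop, qPoch_succ, mul_sub, mul_one]
    nth_rewrite 1 [ih]
    rw [sum_range_succ', ih, sum_mul]
    have : ∀ m, q ^ N * ((∏ i ∈ range m, (q ^ N - q ^ i)) / qPoch q q m) * z ^ (m + 1) =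
        (∏ i ∈ range m, (q ^ N - q ^ i)) / qPoch q q m * z ^ m * (z * q ^ N) := fun m => by
      rw [pow_succ]; ring
    simp_rw [this]
    simp only [range_zero, prod_empty]
    ring

/-- Terminating `A_n` q-binomial theorem (simplex sum). -/
theorem stmt_10 (n : ℕ) (hn : 0 < n) (N : ℕ) (q : ℂ) (hq : q ≠ 0)
    (hqru : ∀ m : ℕ, 0 < m → q ^ m ≠ 1) (z : ℂ)
    (x : Fin n → ℂ) (hx : ∀ i, x i ≠ 0)
    (hxq : ∀ i j : Fin n, i ≠ j → ∀ m : ℤ, x i / x j ≠ q ^ m) :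
    qPoch q z N =
      ∑ k ∈ Finset.filter (fun k : Fin n → ℕ => ∑ i, k i ≤ N)
          (Fintype.piFinset fun _ => Finset.range (N + 1)),
        ((∏ i, ∏ j, if i < j then (x i * q ^ k i - x j * q ^ k j) / (x i - x j) else 1) *
          (∏ i, ∏ j, (qPoch q (q * x i / x j) (k i))⁻¹) *
          qPoch q (q ^ (-(N : ℤ))) (∑ i, k i) * q ^ (N * ∑ i, k i) * z ^ (∑ i, k i)) := by
  rw [qPoch_eq_sum hqru, ← sum_fiberwise_of_maps_to (t := range (N + 1))
    (g := fun k : Fin n → ℕ => ∑ i, k i)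
    (fun k hk => mem_range.2 (Nat.lt_succ_of_le (mem_filter.1 hk).2))]
  refine sum_congr rfl fun m hm => ?_
  have hset : ((Fintype.piFinset fun _ : Fin n => range (N + 1)).filter
      fun k => ∑ i, k i ≤ N).filter (fun k => ∑ i, k i = m) = piAntidiag univ m := by
    ext k
    simp only [mem_filter, Fintype.mem_piFinset, mem_range, mem_piAntidiag, mem_univ,
      implies_true, and_true, and_iff_right_iff_imp]
    intro hk
    have hmN := mem_range_succ_iff.1 hm
    exact ⟨fun i => Nat.lt_succ_of_le
      ((single_le_sum (fun _ _ => Nat.zero_le _) (mem_univ i)).trans (hk.trans_le hmN)),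
      hk.trans_le hmN⟩
  rw [hset, div_eq_mul_inv,
    ← eq_inv_of_mul_eq_one_right (sum_simplexCoeff hn hq hqru hx hxq m), mul_sum, sum_mul]
  refine sum_congr rfl fun k hk => ?_
  rw [(mem_piAntidiag.1 hk).1, ← qPoch_zpow_neg_mul_pow hq, simplexCoeff]
  ring
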